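/- arXiv:1505.00952 — 2 statements merged into one kernel-verified Lean document; each statement's English description precedes it below -/
import Mathlib

section
/- Let v and z be vertices of a D-graph D with v ≺ z, and let u₁, u₂, u₃ be distinct E-vertices belonging to |[z]|^E_v. If ψ_E(u₁,u₂,u₃) and ψ_E(u₂,u₁,u₃), then v is not the closest common pivot of u₁ and u₂ (not v CCP(u₁,u₂)). -/
/-- A graph in the sense of the paper: a finite set of edges, a finite set of
vertices, and West/East end functions (values outside `A` are irrelevant junk,
canonically `0`). -/
structure DGr where
  A : Finset ℕ
  V : Finset ℕ
  W : ℕ → ℕ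
  E : ℕ → ℕ

namespace DGr

/-- The `X`-end function of a graph: `true` stands for `W`, `false` for `E`. -/
def Xf (G : DGr) : Bool → ℕ → ℕ
  | true => G.W
  | false => G.E

/-- `vs`/`es` form a semiwalk: alternating vertices and edges, each edge joining
its two neighbouring vertices in one of the two directions. -/
def IsSemiwalk (G : DGr) (vs es : List ℕ) : Prop :=
  vs.length = es.length + 1 ∧
  (∀ v ∈ vs, v ∈ G.V) ∧ (∀ a ∈ es, a ∈ G.A) ∧
  ∀ (i a u v : ℕ), es[i]? = some a → vs[i]? = some u → vs[i + 1]? = some v →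
    (G.W a = u ∧ G.E a = v) ∨ (G.W a = v ∧ G.E a = u)

/-- A semipath is a semiwalk with no repeated vertex. -/
def IsSemipath (G : DGr) (vs es : List ℕ) : Prop :=
  G.IsSemiwalk vs es ∧ vs.Nodup

/-- A semipath from `u` to `v`. -/
def SemipathFT (G : DGr) (u v : ℕ) (vs es : List ℕ) : Prop :=
  G.IsSemipath vs es ∧ vs.head? = some u ∧ vs.getLast? = some v

/-- A walk: all edges traversed from West to East. -/
def IsWalk (G : DGr) (vs es : List ℕ) : Prop :=
  vs.length = es.length + 1 ∧
  (∀ v ∈ vs, v ∈ G.V) ∧ (∀ a ∈ es, a ∈ G.A) ∧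
  ∀ (i a u v : ℕ), es[i]? = some a → vs[i]? = some u → vs[i + 1]? = some v →
    G.W a = u ∧ G.E a = v

/-- A cycle: a non-trivial closed walk with no repeated vertex except endpoints. -/
def IsCycle (G : DGr) (vs es : List ℕ) : Prop :=
  G.IsWalk vs es ∧ es ≠ [] ∧ vs.head? = vs.getLast? ∧ vs.dropLast.Nodup

def Acyclic (G : DGr) : Prop := ∀ vs es, ¬ G.IsCycle vs es

def WeaklyConnected (G : DGr) : Prop :=
  ∀ u ∈ G.V, ∀ v ∈ G.V, u ≠ v → ∃ vs es, G.SemipathFT u v vs es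

/-- `v` is an `X`-vertex: no edge has its `X̄`-end at `v`. -/
def XVertex (G : DGr) (X : Bool) (v : ℕ) : Prop :=
  v ∈ G.V ∧ ∀ a ∈ G.A, G.Xf (!X) a ≠ v

def InnerVertex (G : DGr) (v : ℕ) : Prop :=
  v ∈ G.V ∧ ¬ G.XVertex true v ∧ ¬ G.XVertex false v

/-- `a` is an `X`-edge: its `X`-end is an `X`-vertex. -/
def XEdge (G : DGr) (X : Bool) (a : ℕ) : Prop :=
  a ∈ G.A ∧ G.XVertex X (G.Xf X a)

def InnerEdge (G : DGr) (a : ℕ) : Prop :=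
  a ∈ G.A ∧ ¬ G.XEdge true a ∧ ¬ G.XEdge false a

def WEFunctional (G : DGr) : Prop :=
  ∀ (X : Bool) (a : ℕ), G.XEdge X a → ∀ b ∈ G.A, b ≠ a → G.Xf X b ≠ G.Xf X a

def WellFormed (G : DGr) : Prop := ∀ a ∈ G.A, G.W a ∈ G.V ∧ G.E a ∈ G.V

/-- A D-graph: finite (built in), acyclic, W-E-functional, weakly connected
graph with an inner vertex. -/
def IsDGraph (G : DGr) : Prop :=
  G.WellFormed ∧ G.Acyclic ∧ G.WEFunctional ∧ G.WeaklyConnected ∧ ∃ v, G.InnerVertex v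

/-- A basic D-graph: a D-graph with a single inner vertex. -/
def IsBasicDGraph (G : DGr) : Prop :=
  G.IsDGraph ∧ ∃! v, G.InnerVertex v

/-- `ψ_X(v,u,w)`: every semipath in `[v,w]` and every semipath in `[u]_{X̄}`
intersect. -/
def psi (G : DGr) (X : Bool) (v u w : ℕ) : Prop :=
  ∀ vs₁ es₁, G.SemipathFT v w vs₁ es₁ →
    ∀ t vs₂ es₂, G.XVertex (!X) t → G.SemipathFT u t vs₂ es₂ →
      ∃ z, z ∈ vs₁ ∧ z ∈ vs₂

/-- `y ▷ [x,z]`: `y` occurs in every semipath from `x` to `z`. -/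
def inAll (G : DGr) (y x z : ℕ) : Prop :=
  ∀ vs es, G.SemipathFT x z vs es → y ∈ vs

/-- `y ≺ x`: `y` is a pivot of `x` (`y` occurs in every semipath in `[x]_W`). -/
def Pivot (G : DGr) (y x : ℕ) : Prop :=
  y ≠ x ∧ ∀ t vs es, G.XVertex true t → G.SemipathFT x t vs es → y ∈ vs

/-- `y ≺_∃ x`: `y` occurs in some semipath in `[x]_W`. -/
def PivotE (G : DGr) (y x : ℕ) : Prop :=
  y ≠ x ∧ ∃ t vs es, G.XVertex true t ∧ G.SemipathFT x t vs es ∧ y ∈ vs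

/-- `v CCP(x,y)`: `v` is the closest common pivot of `x` and `y`. -/
def CCP (G : DGr) (v x y : ℕ) : Prop :=
  G.Pivot v x ∧ G.Pivot v y ∧ ∀ w, G.Pivot w x → G.Pivot w y → (G.Pivot w v ∨ w = v)

end DGr
namespace DGr

open SimpleGraph

theorem last_hit {H : SimpleGraph ℕ} (T : Set ℕ) {a b : ℕ} (Q : H.Walk a b) :
    (∀ w ∈ Q.support, w ∉ T) ∨ ∃ x ∈ T, ∃ q : H.Walk x b, q.support ⊆ Q.support ∧
      ∀ w ∈ q.support, w ∈ T → w = x := by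
  induction Q with
  | nil =>
    rename_i u
    by_cases h : u ∈ T
    · right
      exact ⟨u, h, Walk.nil, by simp, by simp⟩
    · left; simpa using h
  | cons h p ih =>
    rename_i u v w
    rcases ih with ih | ⟨x, hx, q, hq, hq2⟩
    · by_cases hu : u ∈ T
      · right
        refine ⟨u, hu, Walk.cons h p, by simp, ?_⟩
        intro w hw hwT
        rw [Walk.support_cons, List.mem_cons] at hw
        rcases hw with hw | hw
        · exact hw
        · exact absurd hwT (ih w hw)
      · left
        intro w hw
        rw [Walk.support_cons, List.mem_cons] at hw
        rcases hw with hw | hw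
        · rwa [hw]
        · exact ih w hw
    · right
      refine ⟨x, hx, q, ?_, hq2⟩
      intro w hw
      rw [Walk.support_cons]
      exact List.mem_cons_of_mem _ (hq hw)

theorem leaf_not_mem {H : SimpleGraph ℕ} {c : ℕ} (hc : ∀ x y, H.Adj x c → H.Adj y c → x = y)
    {a b : ℕ} (p : H.Walk a b) (hp : p.IsPath) (ha : c ≠ a) (hb : c ≠ b) : c ∉ p.support := by
  induction p with
  | nil => simpa using ha
  | cons h p ih =>
    rename_i u w b
    rw [Walk.cons_isPath_iff] at hp
    rw [Walk.support_cons, List.mem_cons, not_or]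
    refine ⟨ha, ?_⟩
    by_cases hw : c = w
    · subst hw
      exfalso
      cases p with
      | nil => exact hb rfl
      | cons h2 p2 =>
        rename_i w2
        have := hc _ _ h h2.symm
        subst this
        apply hp.2
        simp
    · exact ih hp.1 hw hb

/-- two-fan -/
def Fan (H : SimpleGraph ℕ) (u₁ u₂ y : ℕ) : Prop :=
  ∃ (p₁ : H.Walk u₁ y) (p₂ : H.Walk u₂ y), p₁.IsPath ∧ p₂.IsPath ∧
    ∀ x ∈ p₁.support, x ∈ p₂.support → x = y

def Sep (H : SimpleGraph ℕ) (u₁ u₂ w y : ℕ) : Prop :=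
  (∀ p : H.Walk u₁ y, w ∈ p.support) ∧ (∀ p : H.Walk u₂ y, w ∈ p.support)

theorem Fan.symm {H : SimpleGraph ℕ} {u₁ u₂ y : ℕ} (h : Fan H u₁ u₂ y) : Fan H u₂ u₁ y := by
  obtain ⟨p₁, p₂, h1, h2, h3⟩ := h
  exact ⟨p₂, p₁, h2, h1, fun x a b => h3 x b a⟩

theorem fan_mk {H : SimpleGraph ℕ} {u₁ u₂ y : ℕ} (p₁ : H.Walk u₁ y) (p₂ : H.Walk u₂ y)
    (h : ∀ x ∈ p₁.support, x ∈ p₂.support → x = y) : Fan H u₁ u₂ y :=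
  ⟨p₁.bypass, p₂.bypass, p₁.bypass_isPath, p₂.bypass_isPath,
    fun x a b => h x (p₁.support_bypass_subset_support a) (p₂.support_bypass_subset_support b)⟩

theorem fan_ext {H : SimpleGraph ℕ} {u₁ u₂ y v x : ℕ} (hyv : H.Adj y v)
    (p₁ : H.Walk u₁ y) (p₂ : H.Walk u₂ y) (hp₁ : p₁.IsPath)
    (hd : ∀ x ∈ p₁.support, x ∈ p₂.support → x = y)
    (hx : x ∈ p₁.support) (hxy : x ≠ y) (q : H.Walk x v) (hq : y ∉ q.support)
    (hv : v ∉ p₁.support ∨ x = v)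
    (hqd : ∀ w ∈ q.support, w ∈ p₂.support → w = x) : Fan H u₁ u₂ v := by
  refine fan_mk ((p₁.takeUntil x hx).append q) (p₂.append (Walk.cons hyv Walk.nil)) ?_
  intro w hw hw2
  rw [Walk.mem_support_append_iff] at hw hw2
  have hw2' : w ∈ p₂.support ∨ w = v := by
    rcases hw2 with h | h
    · exact Or.inl h
    · simp at h
      rcases h with h | h
      · left; rw [h]; exact p₂.end_mem_support
      · exact Or.inr h
  rcases hw2' with h2 | h2
  · exfalso
    rcases hw with h | h
    · have := hd w (p₁.support_takeUntil_subset_support hx h) h2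
      subst this
      exact Walk.endpoint_notMem_support_takeUntil hp₁ hx hxy.symm h
    · have h3 := hqd w h h2
      subst h3
      exact hxy (hd w hx h2)
  · exact h2

theorem fan_step {H : SimpleGraph ℕ} {u₁ u₂ y v : ℕ} (hyv : H.Adj y v)
    (hf : Fan H u₁ u₂ y) (hs : ∀ w, w ≠ v → ¬ Sep H u₁ u₂ w v) : Fan H u₁ u₂ v := by
  obtain ⟨p₁, p₂, hp₁, hp₂, hd⟩ := hf
  have hd' : ∀ x ∈ p₂.support, x ∈ p₁.support → x = y := fun x a b => hd x b a
  by_cases h1 : v ∈ p₁.support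
  · refine fan_ext hyv p₁ p₂ hp₁ hd h1 hyv.ne' Walk.nil (by simpa using hyv.ne) (Or.inr rfl) ?_
    intro w hw _; simpa using hw
  by_cases h2 : v ∈ p₂.support
  · refine (fan_ext hyv p₂ p₁ hp₂ hd' h2 hyv.ne' Walk.nil (by simpa using hyv.ne)
      (Or.inr rfl) ?_).symm
    intro w hw _; simpa using hw
  have key : ∃ u, (u ∈ p₁.support ∨ u ∈ p₂.support) ∧ ∃ Q : H.Walk u v, y ∉ Q.support := by
    have := hs y hyv.ne
    unfold Sep at this
    rw [not_and_or] at this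
    rcases this with h | h
    · push Not at h
      exact ⟨u₁, Or.inl p₁.start_mem_support, h⟩
    · push Not at h
      exact ⟨u₂, Or.inr p₂.start_mem_support, h⟩
  obtain ⟨u, hu, Q, hQ⟩ := key
  rcases last_hit {x | x ∈ p₁.support ∨ x ∈ p₂.support} Q with h | ⟨x, hx, q, hqs, hq⟩
  · exact absurd hu (h u Q.start_mem_support)
  have hyq : y ∉ q.support := fun h => hQ (hqs h)
  have hxy : x ≠ y := fun h => hyq (h ▸ q.start_mem_support)
  rcases hx with hx | hx
  · exact fan_ext hyv p₁ p₂ hp₁ hd hx hxy q hyq (Or.inl h1) (fun w a b => hq w a (Or.inr b))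
  · exact (fan_ext hyv p₂ p₁ hp₂ hd' hx hxy q hyq (Or.inl h2)
      (fun w a b => hq w a (Or.inl b))).symm

theorem fan_or_sep {H : SimpleGraph ℕ} {u₁ u₂ : ℕ} (h0 : H.Walk u₂ u₁) {y : ℕ}
    (p : H.Walk y u₁) (hp : p.IsPath) : Fan H u₁ u₂ y ∨ ∃ w, w ≠ y ∧ Sep H u₁ u₂ w y := by
  induction p with
  | nil =>
    left
    exact fan_mk Walk.nil h0 (by intro x hx _; simpa using hx)
  | cons h p ih =>
    rename_i v y b
    rw [Walk.cons_isPath_iff] at hp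
    by_cases hs : ∃ w, w ≠ v ∧ Sep H b u₂ w v
    · exact Or.inr hs
    left
    push Not at hs
    rcases ih h0 hp.1 with hf | ⟨w, hwy, hw⟩
    · exact fan_step h.symm hf hs
    · exfalso
      by_cases hwv : w = v
      · subst hwv
        have := hw.1 p.reverse
        rw [Walk.support_reverse, List.mem_reverse] at this
        exact hp.2 this
      · apply hs w hwv
        constructor
        · intro q
          have := hw.1 (q.append (Walk.cons h Walk.nil))
          rw [Walk.mem_support_append_iff] at this
          rcases this with h | h
          · exact h
          · simp [hwv, hwy] at h
        · intro q
          have := hw.2 (q.append (Walk.cons h Walk.nil))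
          rw [Walk.mem_support_append_iff] at this
          rcases this with h | h
          · exact h
          · simp [hwv, hwy] at h

theorem half {H : SimpleGraph ℕ} {u₁ u₂ u₃ v t x : ℕ}
    (p₁ : H.Walk u₁ v) (p₂ : H.Walk u₂ v) (hp₁ : p₁.IsPath)
    (hd : ∀ x ∈ p₁.support, x ∈ p₂.support → x = v)
    (hx : x ∈ p₁.support) (q : H.Walk x u₃) (hq : v ∉ q.support)
    (hqd : ∀ w ∈ q.support, w ∈ p₂.support → w = x)
    (r : H.Walk v t) (hr : r.IsPath)
    (piv : ∀ p : H.Walk u₁ t, v ∈ p.support)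
    (psi : ∀ (R : H.Walk u₁ u₃) (S : H.Walk u₂ t), ∃ y, y ∈ R.support ∧ y ∈ S.support) :
    False := by
  have hxv : x ≠ v := fun h => hq (h ▸ q.start_mem_support)
  have hvR : v ∉ ((p₁.takeUntil x hx).append q).support := by
    rw [Walk.mem_support_append_iff, not_or]
    exact ⟨Walk.endpoint_notMem_support_takeUntil hp₁ hx hxv.symm, hq⟩
  obtain ⟨y, hy1, hy2⟩ := psi ((p₁.takeUntil x hx).append q) (p₂.append r)
  have hyv : y ≠ v := fun h => hvR (h ▸ hy1)
  rw [Walk.mem_support_append_iff] at hy2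
  rcases hy2 with hy2 | hy2
  · rw [Walk.mem_support_append_iff] at hy1
    rcases hy1 with h | h
    · exact hyv (hd y (p₁.support_takeUntil_subset_support hx h) hy2)
    · have := hqd y h hy2
      subst this
      exact hxv (hd y hx hy2)
  · have h := piv ((((p₁.takeUntil x hx).append q).takeUntil y hy1).append (r.dropUntil y hy2))
    rw [Walk.mem_support_append_iff] at h
    rcases h with h | h
    · exact hvR (Walk.support_takeUntil_subset_support _ hy1 h)
    · have h2 := Walk.endpoint_notMem_support_takeUntil hr.reverse
        (by rw [Walk.support_reverse, List.mem_reverse]; exact hy2 : y ∈ r.reverse.support) hyv.symm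
      have h3 : r.support.Nodup := hr.support_nodup
      rw [← Walk.take_spec r hy2, Walk.support_append] at h3
      have h4 := (List.nodup_append.1 h3).2.2 v (Walk.start_mem_support _) v
      have h5 : v ∈ (r.dropUntil y hy2).support.tail := by
        rw [Walk.support_eq_cons, List.mem_cons] at h
        rcases h with h | h
        · exact absurd h.symm hyv
        · exact h
      exact h4 h5 rfl

theorem core {H : SimpleGraph ℕ} {u₁ u₂ u₃ v t : ℕ}
    (Q12 : H.Walk u₂ u₁) (Q13 : H.Walk u₁ u₃) (hQ13 : v ∉ Q13.support)
    (r : H.Walk v t) (hr : r.IsPath) (p : H.Walk v u₁) (hp : p.IsPath)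
    (hs : ∀ w, w ≠ v → ¬ Sep H u₁ u₂ w v)
    (piv₁ : ∀ p : H.Walk u₁ t, v ∈ p.support)
    (piv₂ : ∀ p : H.Walk u₂ t, v ∈ p.support)
    (psi₁ : ∀ (R : H.Walk u₁ u₃) (S : H.Walk u₂ t), ∃ y, y ∈ R.support ∧ y ∈ S.support)
    (psi₂ : ∀ (R : H.Walk u₂ u₃) (S : H.Walk u₁ t), ∃ y, y ∈ R.support ∧ y ∈ S.support) :
    False := by
  rcases fan_or_sep Q12 p hp with hf | ⟨w, h1, h2⟩
  swap
  · exact hs w h1 h2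
  obtain ⟨p₁, p₂, hp₁, hp₂, hd⟩ := hf
  rcases last_hit {x | x ∈ p₁.support ∨ x ∈ p₂.support} Q13 with h | ⟨x, hx, q, hqs, hq⟩
  · exact absurd (Or.inl p₁.start_mem_support) (h u₁ Q13.start_mem_support)
  have hvq : v ∉ q.support := fun h => hQ13 (hqs h)
  rcases hx with hx | hx
  · exact half p₁ p₂ hp₁ hd hx q hvq (fun w a b => hq w a (Or.inr b)) r hr piv₁ psi₁
  · exact half p₂ p₁ hp₂ (fun x a b => hd x b a) hx q hvq (fun w a b => hq w a (Or.inl b))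
      r hr piv₂ psi₂

/-- underlying simple graph -/
def U (G : DGr) : SimpleGraph ℕ where
  Adj x y := x ≠ y ∧ ∃ a ∈ G.A, (G.W a = x ∧ G.E a = y) ∨ (G.W a = y ∧ G.E a = x)
  symm := ⟨fun x y h => ⟨h.1.symm, by
    obtain ⟨a, ha, h⟩ := h.2
    exact ⟨a, ha, h.symm⟩⟩⟩
  loopless := ⟨fun x h => h.1 rfl⟩

theorem path_to_semi {G : DGr} (hW : G.WellFormed) {a b : ℕ} (p : G.U.Walk a b)
    (ha : a ∈ G.V) : ∃ es, G.IsSemiwalk p.support es := by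
  induction p with
  | nil =>
    exact ⟨[], by simp, by simpa using ha, by simp, by simp⟩
  | cons h p ih =>
    rename_i u w b
    obtain ⟨c, hc, h2⟩ := h.2
    have hw : w ∈ G.V := by
      rcases h2 with h2 | h2
      · rw [← h2.2]; exact (hW c hc).2
      · rw [← h2.1]; exact (hW c hc).1
    obtain ⟨es, e1, e2, e3, e4⟩ := ih hw
    refine ⟨c :: es, ?_, ?_, ?_, ?_⟩
    · simp at e1 ⊢; exact e1
    · intro x hx
      rw [Walk.support_cons, List.mem_cons] at hx
      rcases hx with hx | hx
      · rwa [hx]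
      · exact e2 x hx
    · intro x hx
      rw [List.mem_cons] at hx
      rcases hx with hx | hx
      · rwa [hx]
      · exact e3 x hx
    · intro i x y z h1 h3 h4
      rw [Walk.support_cons] at h3 h4
      cases i with
      | zero =>
        rw [Walk.support_eq_cons] at h4
        simp at h1 h3 h4
        subst h1 h3 h4
        exact h2
      | succ i =>
        simp only [List.getElem?_cons_succ] at h1 h3 h4
        exact e4 i x y z h1 h3 h4

theorem walk_to_ft {G : DGr} (hW : G.WellFormed) {a b : ℕ} (p : G.U.Walk a b)
    (ha : a ∈ G.V) : ∃ vs es, G.SemipathFT a b vs es ∧ vs ⊆ p.support := by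
  obtain ⟨es, hes⟩ := path_to_semi hW p.bypass ha
  refine ⟨_, es, ⟨⟨hes, p.bypass_isPath.support_nodup⟩, ?_, ?_⟩, p.support_bypass_subset_support⟩
  · rw [Walk.support_eq_cons]; rfl
  · rw [List.getLast?_eq_getLast_of_ne_nil (Walk.support_ne_nil _), Walk.getLast_support]

theorem ft_to_walk {G : DGr} (es : List ℕ) : ∀ {a b : ℕ} (vs : List ℕ),
    G.SemipathFT a b vs es → ∃ p : G.U.Walk a b, p.support = vs := by
  induction es with
  | nil =>
    rintro a b vs ⟨⟨⟨h1, h2, h3, h4⟩, h5⟩, h6, h7⟩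
    obtain ⟨x, rfl⟩ := List.length_eq_one_iff.1 h1
    simp at h6 h7
    subst h6 h7
    exact ⟨Walk.nil, rfl⟩
  | cons e es ih =>
    rintro a b vs ⟨⟨⟨h1, h2, h3, h4⟩, h5⟩, h6, h7⟩
    match vs, h1, h2, h4, h5, h6, h7 with
    | [], h1, _, _, _, _, _ => simp at h1
    | [x], h1, _, _, _, _, _ => simp at h1
    | x :: y :: vs, h1, h2, h4, h5, h6, h7 =>
      simp at h6
      subst h6
      obtain ⟨p, hp⟩ := ih (a := y) (b := b) (y :: vs) ⟨⟨⟨by simpa using h1,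
        fun v hv => h2 v (List.mem_cons_of_mem _ hv), fun v hv => h3 v (List.mem_cons_of_mem _ hv),
        fun i a u v q1 q2 q3 => h4 (i+1) a u v (by simpa using q1) (by simpa using q2)
          (by simpa using q3)⟩, (List.nodup_cons.1 h5).2⟩, rfl, by
            rw [List.getLast?_cons_cons] at h7; exact h7⟩
      have hadj : G.U.Adj x y := by
        refine ⟨?_, e, h3 e (by simp), h4 0 e x y rfl rfl rfl⟩
        intro h
        subst h
        simp at h5
      exact ⟨Walk.cons hadj p, by rw [Walk.support_cons, hp]⟩

theorem exists_W {G : DGr} (hW : G.WellFormed) (hA : G.Acyclic) (hV : ∃ v, v ∈ G.V) :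
    ∃ t, G.XVertex true t := by
  by_contra hno
  have h1 : ∀ v : ℕ, ∃ a, v ∈ G.V → a ∈ G.A ∧ G.E a = v := by
    intro v
    by_cases hv : v ∈ G.V
    · by_contra hc
      push Not at hc
      apply hno
      refine ⟨v, hv, ?_⟩
      intro a ha h
      exact (hc a).2 ha h
    · exact ⟨0, fun h => absurd h hv⟩
  choose e he using h1
  let f : ℕ → ℕ := fun v => G.W (e v)
  have hf : ∀ v ∈ G.V, f v ∈ G.V := fun v hv => (hW _ (he v hv).1).1
  obtain ⟨x0, hx0⟩ := hV
  have hit : ∀ x ∈ G.V, ∀ n, f^[n] x ∈ G.V := by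
    intro x hx n
    induction n with
    | zero => exact hx
    | succ n ih => rw [Function.iterate_succ_apply']; exact hf _ ih
  obtain ⟨x, hx, hper⟩ : ∃ x ∈ G.V, x ∈ Function.periodicPts f := by
    obtain ⟨i, j, hij, h⟩ := Finite.exists_ne_map_eq_of_infinite
      (fun n : ℕ => (⟨f^[n] x0, hit x0 hx0 n⟩ : G.V))
    simp only [Subtype.mk.injEq] at h
    have gen : ∀ i j : ℕ, i < j → f^[i] x0 = f^[j] x0 →
        ∃ x ∈ G.V, x ∈ Function.periodicPts f := by
      intro i j hlt h
      refine ⟨f^[i] x0, hit x0 hx0 i, Function.mk_mem_periodicPts (n := j - i) (by omega) ?_⟩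
      rw [Function.IsPeriodicPt, Function.IsFixedPt, ← Function.iterate_add_apply, h]
      congr 2; omega
    rcases lt_or_gt_of_ne hij with h' | h'
    · exact gen i j h' h
    · exact gen j i h' h.symm
  set n := Function.minimalPeriod f x with hn
  have hn0 : 0 < n := Function.minimalPeriod_pos_of_mem_periodicPts hper
  have hnx : f^[n] x = x := Function.isPeriodicPt_minimalPeriod f x
  apply hA ((List.range (n+1)).map (fun i => f^[n-i] x))
    ((List.range n).map (fun i => e (f^[n-1-i] x)))
  refine ⟨⟨by simp, ?_, ?_, ?_⟩, ?_, ?_, ?_⟩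
  · intro v hv
    obtain ⟨i, -, rfl⟩ := List.mem_map.1 hv
    exact hit x hx _
  · intro v hv
    obtain ⟨i, -, rfl⟩ := List.mem_map.1 hv
    exact (he _ (hit x hx _)).1
  · intro i a u w q1 q2 q3
    have hi : i < n := by
      have := (List.getElem?_eq_some_iff.1 q1).1
      simpa using this
    rw [List.getElem?_map, List.getElem?_range (by omega)] at q1 q2 q3
    simp at q1 q2 q3
    subst q1 q2 q3
    constructor
    · have : n - i = (n - 1 - i) + 1 := by omega
      rw [this, Function.iterate_succ_apply']
    · rw [(he _ (hit x hx _)).2]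
      have : n - 1 - i = n - (i + 1) := by omega
      rw [this]
  · simp; omega
  · rw [List.range_succ]
    simp only [List.map_append, List.map_cons, List.map_nil, List.getLast?_append]
    rw [← List.map_singleton (f := (fun i => f^[n-i] x)), ← List.map_append, ← List.range_succ, List.range_succ_eq_map]
    simp [hnx]
  · rw [List.range_succ, List.map_append, List.map_singleton, List.dropLast_concat]
    apply List.Nodup.map_on _ List.nodup_range
    intro i hi j hj h
    rw [List.mem_range] at hi hj
    have h2 : ∀ i, i < n → f^[n-1] (f^[n-i] x) = f^[n-1-i] x := by
      intro i hi
      rw [← Function.iterate_add_apply]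
      have : n - 1 + (n - i) = (n - 1 - i) + n := by omega
      rw [this, Function.iterate_add_apply, hnx]
    have h3 := congrArg (f^[n-1]) h
    rw [h2 i hi, h2 j hj] at h3
    have := (Function.iterate_eq_iterate_iff_of_lt_minimalPeriod (f := f) (x := x)
      (by omega) (by omega)).1 h3
    omega

theorem E_leaf {G : DGr} (hF : G.WEFunctional) {u : ℕ} (hu : G.XVertex false u) :
    ∀ x y, G.U.Adj x u → G.U.Adj y u → x = y := by
  have key : ∀ x, G.U.Adj x u → ∃ a ∈ G.A, G.W a = x ∧ G.E a = u := by
    rintro x ⟨-, a, ha, h | h⟩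
    · exact ⟨a, ha, h⟩
    · exact absurd h.1 (hu.2 a ha)
  intro x y hx hy
  obtain ⟨a, ha, h1, h2⟩ := key x hx
  obtain ⟨b, hb, h3, h4⟩ := key y hy
  by_cases hab : b = a
  · rw [← h1, ← h3, hab]
  · exfalso
    exact hF false a ⟨ha, by change G.XVertex false (G.E a); rwa [h2]⟩ b hb hab
      (h4.trans h2.symm)

theorem exists_path {G : DGr} (hC : G.WeaklyConnected) {a b : ℕ} (ha : a ∈ G.V) (hb : b ∈ G.V) :
    ∃ p : G.U.Walk a b, p.IsPath := by
  by_cases h : a = b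
  · subst h; exact ⟨Walk.nil, Walk.IsPath.nil⟩
  · obtain ⟨vs, es, h⟩ := hC a ha b hb h
    obtain ⟨p, -⟩ := ft_to_walk es vs h
    exact ⟨p.bypass, p.bypass_isPath⟩

theorem avoid {G : DGr} {v a b : ℕ} (h : ¬ G.inAll v a b) :
    ∃ p : G.U.Walk a b, v ∉ p.support := by
  unfold inAll at h
  push Not at h
  obtain ⟨vs, es, h1, h2⟩ := h
  obtain ⟨p, hp⟩ := ft_to_walk es vs h1
  exact ⟨p, by rwa [hp]⟩

theorem piv_walk {G : DGr} (hW : G.WellFormed) {v u t : ℕ} (hu : u ∈ G.V)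
    (h : G.Pivot v u) (ht : G.XVertex true t) (p : G.U.Walk u t) : v ∈ p.support := by
  obtain ⟨vs, es, h1, h2⟩ := walk_to_ft hW p hu
  exact h2 (h.2 t vs es ht h1)

theorem psi_walk {G : DGr} (hW : G.WellFormed) {a b c t : ℕ} (ha : a ∈ G.V) (hb : b ∈ G.V)
    (h : G.psi false a b c) (ht : G.XVertex true t) (R : G.U.Walk a c) (S : G.U.Walk b t) :
    ∃ y, y ∈ R.support ∧ y ∈ S.support := by
  obtain ⟨vs, es, h1, h2⟩ := walk_to_ft hW R ha
  obtain ⟨vs', es', h1', h2'⟩ := walk_to_ft hW S hb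
  obtain ⟨y, hy, hy'⟩ := h vs es h1 t vs' es' ht h1'
  exact ⟨y, h2 hy, h2' hy'⟩

theorem piv_of_sep {G : DGr} {v w u : ℕ} (hwu : w ≠ u) (hp : G.Pivot v u)
    (hs : ∀ p : G.U.Walk u v, w ∈ p.support) : G.Pivot w u := by
  refine ⟨hwu, ?_⟩
  intro t vs es ht h
  have hv := hp.2 t vs es ht h
  obtain ⟨p, rfl⟩ := ft_to_walk es vs h
  exact p.support_takeUntil_subset_support hv (hs _)

end DGr

/-- **Lemma 4.2.3**: if `u₁, u₂, u₃` are distinct E-vertices in the petal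
`|[z]|^E_v` (i.e. `v ≺ uᵢ` and not `v ▷ [z,uᵢ]`), and `ψ_E(u₁,u₂,u₃)` and
`ψ_E(u₂,u₁,u₃)` hold, then `v` is not the closest common pivot of `u₁`, `u₂`. -/
theorem not_ccp_in_petal (G : DGr) (hG : G.IsDGraph)
    (v z : ℕ) (hvV : v ∈ G.V) (hzV : z ∈ G.V) (hvz : G.Pivot v z)
    (u₁ u₂ u₃ : ℕ)
    (hu₁ : G.XVertex false u₁) (hu₂ : G.XVertex false u₂) (hu₃ : G.XVertex false u₃)
    (h12 : u₁ ≠ u₂) (h13 : u₁ ≠ u₃) (h23 : u₂ ≠ u₃)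
    (hp₁ : G.Pivot v u₁ ∧ ¬ G.inAll v z u₁)
    (hp₂ : G.Pivot v u₂ ∧ ¬ G.inAll v z u₂)
    (hp₃ : G.Pivot v u₃ ∧ ¬ G.inAll v z u₃)
    (hψ₁ : G.psi false u₁ u₂ u₃) (hψ₂ : G.psi false u₂ u₁ u₃) :
    ¬ G.CCP v u₁ u₂ := by
  rintro ⟨-, -, hccp⟩
  obtain ⟨hW, hA, hF, hC, -⟩ := hG
  obtain ⟨t, ht⟩ := DGr.exists_W hW hA ⟨v, hvV⟩
  obtain ⟨r, hr⟩ := DGr.exists_path hC hvV ht.1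
  obtain ⟨p, hp⟩ := DGr.exists_path hC hvV hu₁.1
  obtain ⟨Q12, hQ12⟩ := DGr.exists_path hC hu₂.1 hu₁.1
  obtain ⟨a, ha⟩ := DGr.avoid hp₁.2
  obtain ⟨b, hb⟩ := DGr.avoid hp₃.2
  refine DGr.core (v := v) Q12 (a.reverse.append b) ?_ r hr p hp ?_
    (DGr.piv_walk hW hu₁.1 hp₁.1 ht) (DGr.piv_walk hW hu₂.1 hp₂.1 ht)
    (DGr.psi_walk hW hu₁.1 hu₂.1 hψ₁ ht) (DGr.psi_walk hW hu₂.1 hu₁.1 hψ₂ ht)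
  · rw [SimpleGraph.Walk.mem_support_append_iff, not_or, SimpleGraph.Walk.support_reverse,
      List.mem_reverse]
    exact ⟨ha, hb⟩
  · intro w hwv hs
    have hw1 : w ≠ u₁ := by
      rintro rfl
      obtain ⟨q, hq⟩ := DGr.exists_path hC hu₂.1 hvV
      exact DGr.leaf_not_mem (DGr.E_leaf hF hu₁) q hq h12 hwv (hs.2 q)
    have hw2 : w ≠ u₂ := by
      rintro rfl
      obtain ⟨q, hq⟩ := DGr.exists_path hC hu₁.1 hvV
      exact DGr.leaf_not_mem (DGr.E_leaf hF hu₂) q hq h12.symm hwv (hs.1 q)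
    rcases hccp w (DGr.piv_of_sep hw1 hp₁.1 hs.1) (DGr.piv_of_sep hw2 hp₂.1 hs.2) with h | h
    · obtain ⟨s, hs'⟩ := DGr.exists_path hC hu₁.1 ht.1
      have hv := DGr.piv_walk hW hu₁.1 hp₁.1 ht s
      have h1 := hs.1 (s.takeUntil v hv)
      have h2 := DGr.piv_walk hW hvV h ht (s.dropUntil v hv)
      have h3 : s.support.Nodup := hs'.support_nodup
      rw [← SimpleGraph.Walk.take_spec s hv, SimpleGraph.Walk.support_append] at h3
      rw [SimpleGraph.Walk.support_eq_cons, List.mem_cons] at h2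
      rcases h2 with h2 | h2
      · exact hwv h2
      · exact (List.nodup_append.1 h3).2.2 w h1 w h2 rfl
    · exact hwv h
end

section
/- Let v₁, v₂, v₃, v₄ be four distinct points occurring in that order on the boundary of a topological disk κ in ℝ². Then every open Jordan curve joining v₁ and v₃ and included in κ intersects every open Jordan curve joining v₂ and v₄ and included in κ. -/
theorem aux_arg (α : ℝ) (h0 : 0 < α) (h1 : α < 2 * Real.pi) :
    Complex.arg (1 - Complex.exp (α * Complex.I)) = (α - Real.pi) / 2 := by
  have hs : 0 < Real.sin (α / 2) := Real.sin_pos_of_pos_of_lt_pi (by linarith) (by linarith)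
  have key := Complex.arg_mul_cos_add_sin_mul_I (r := 2 * Real.sin (α / 2)) (by linarith)
    (θ := (α - Real.pi) / 2) ⟨by linarith, by linarith⟩
  rw [← key]
  congr 1
  have e1 : (α - Real.pi) / 2 = α / 2 - Real.pi / 2 := by ring
  rw [← Complex.ofReal_cos, ← Complex.ofReal_sin, e1, Real.cos_sub_pi_div_two,
    Real.sin_sub_pi_div_two, Complex.exp_mul_I, ← Complex.ofReal_cos, ← Complex.ofReal_sin]
  have e2 : Real.cos α = 1 - 2 * Real.sin (α / 2) ^ 2 := by
    have := Real.cos_two_mul (α / 2)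
    have h3 := Real.sin_sq_add_cos_sq (α / 2)
    rw [show 2 * (α / 2) = α by ring] at this
    linarith
  have e3 : Real.sin α = 2 * Real.sin (α / 2) * Real.cos (α / 2) := by
    have := Real.sin_two_mul (α / 2)
    rwa [show 2 * (α / 2) = α by ring] at this
  rw [e2, e3]
  push_cast
  ring

theorem aux_arg' (α : ℝ) (h0 : -(2 * Real.pi) < α) (h1 : α < 0) :
    Complex.arg (1 - Complex.exp (α * Complex.I)) = (α + Real.pi) / 2 := by
  have := aux_arg (α + 2 * Real.pi) (by linarith) (by linarith)
  rw [show (((α + 2 * Real.pi : ℝ) : ℂ) * Complex.I) = α * Complex.I + 2 * Real.pi * Complex.I by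
    push_cast; ring, Complex.exp_periodic] at this
  rw [this]; ring

theorem aux_edge (L w : ℝ → ℂ) (c : ℂ) (hL : Continuous L) (hw : Continuous w)
    (hs : ∀ t, w t ∈ Complex.slitPlane) (he : ∀ t, Complex.exp (L t) = c * w t) :
    (L 1).im - (L 0).im = (w 1).arg - (w 0).arg := by
  have hc : Continuous (fun t => L t - Complex.log (w t)) := hL.sub (hw.clog hs)
  have := Complex.isCoveringMap_exp.const_of_comp hc (fun a b => by
    have hh : ∀ t, Complex.exp (L t - Complex.log (w t)) = c := fun t => by
      have h0 := Complex.slitPlane_ne_zero (hs t)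
      rw [Complex.exp_sub, he, Complex.exp_log h0]
      field_simp
    ext1
    simp only [hh]) 1 0
  have h2 := congrArg Complex.im this
  simp only [Complex.sub_im, Complex.log_im] at h2
  linarith

/-- Edge: `ε * exp (iβ) * (1 - exp(-iβ) G)`. -/
theorem aux_edge2 (L G : ℝ → ℂ) (ε : ℂ) (β a b : ℝ) (hL : Continuous L) (hG : Continuous G)
    (hn : ∀ t, ‖G t‖ ≤ 1)
    (he : ∀ t, Complex.exp (L t) = ε * (Complex.exp (β * Complex.I) - G t))
    (h0 : G 0 = Complex.exp (a * Complex.I)) (h1 : G 1 = Complex.exp (b * Complex.I)) :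
    (L 1).im - (L 0).im = (1 - Complex.exp ((b - β : ℝ) * Complex.I)).arg
      - (1 - Complex.exp ((a - β : ℝ) * Complex.I)).arg := by
  have hE : ∀ t, Complex.exp (β * Complex.I) * (1 - Complex.exp (-(β * Complex.I)) * G t)
      = Complex.exp (β * Complex.I) - G t := fun t => by
    rw [mul_sub, ← mul_assoc, ← Complex.exp_add]; simp
  have hnn : ∀ t, ‖Complex.exp (-(β * Complex.I)) * G t‖ ≤ 1 := fun t => by
    rw [norm_mul, Complex.norm_exp]
    simpa using hn t
  have hE2 : ∀ x : ℝ, Complex.exp (-(β * Complex.I)) * Complex.exp (x * Complex.I)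
      = Complex.exp ((x - β : ℝ) * Complex.I) := fun x => by
    rw [← Complex.exp_add]; congr 1; push_cast; ring
  have := aux_edge L (fun t => 1 - Complex.exp (-(β * Complex.I)) * G t)
    (ε * Complex.exp (β * Complex.I)) hL (by fun_prop) (fun t => ?_)
    (fun t => by rw [he, mul_assoc, hE])
  · rw [this, h0, h1, hE2, hE2]
  · have hne : 1 - Complex.exp (-(β * Complex.I)) * G t ≠ 0 := by
      intro hz
      have := he t
      rw [← hE, hz] at this
      simp at this
    have hre := (Complex.re_le_norm _).trans (hnn t)
    rw [Complex.mem_slitPlane_iff]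
    by_contra hcon
    push Not at hcon
    apply hne
    apply Complex.ext
    · have : (1 - Complex.exp (-(β * Complex.I)) * G t).re
        = 1 - (Complex.exp (-(β * Complex.I)) * G t).re := by simp only [Complex.sub_re, Complex.one_re]
      rw [Complex.zero_re]
      linarith [hcon.1]
    · exact hcon.2

theorem aux_main (θ : Fin 4 → ℝ)
    (hord : θ 0 < θ 1 ∧ θ 1 < θ 2 ∧ θ 2 < θ 3 ∧ θ 3 < θ 0 + 2 * Real.pi)
    (F G : ℝ → ℂ) (hF : Continuous F) (hG : Continuous G)
    (hFn : ∀ t, ‖F t‖ ≤ 1) (hGn : ∀ t, ‖G t‖ ≤ 1)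
    (hF0 : F 0 = Complex.exp (θ 0 * Complex.I)) (hF1 : F 1 = Complex.exp (θ 2 * Complex.I))
    (hG0 : G 0 = Complex.exp (θ 1 * Complex.I)) (hG1 : G 1 = Complex.exp (θ 3 * Complex.I)) :
    ∃ s t, F s = G t := by
  by_contra hcon
  push Not at hcon
  obtain ⟨h1, h2, h3, h4⟩ := hord
  let D : C(ℝ × ℝ, ℂ) := ⟨fun p => F p.1 - G p.2, by fun_prop⟩
  have hD : ∀ p, D p ≠ 0 := fun p => sub_ne_zero.2 (hcon _ _)
  obtain ⟨L, ⟨-, hL⟩, -⟩ := Complex.isCoveringMapOn_exp.existsUnique_continuousMap_lifts D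
    (a₀ := (0, 0)) (e₀ := Complex.log (D (0, 0))) (Complex.exp_log (hD _)) hD
  have hL' : ∀ s t, Complex.exp (L (s, t)) = F s - G t := fun s t => congrFun hL (s, t)
  have A := aux_edge2 (fun t => L (0, t)) G 1 (θ 0) (θ 1) (θ 3) (by fun_prop) hG hGn
    (fun t => by rw [hL', hF0, one_mul]) hG0 hG1
  have B := aux_edge2 (fun t => L (1, t)) G 1 (θ 2) (θ 1) (θ 3) (by fun_prop) hG hGn
    (fun t => by rw [hL', hF1, one_mul]) hG0 hG1
  have C := aux_edge2 (fun s => L (s, 0)) F (-1) (θ 1) (θ 0) (θ 2) (by fun_prop) hF hFn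
    (fun t => by rw [hL', hG0]; ring) hF0 hF1
  have E := aux_edge2 (fun s => L (s, 1)) F (-1) (θ 3) (θ 0) (θ 2) (by fun_prop) hF hFn
    (fun t => by rw [hL', hG1]; ring) hF0 hF1
  rw [aux_arg _ (by linarith) (by linarith), aux_arg _ (by linarith) (by linarith)] at A
  rw [aux_arg _ (by linarith) (by linarith), aux_arg' _ (by linarith) (by linarith)] at B
  rw [aux_arg _ (by linarith) (by linarith), aux_arg' _ (by linarith) (by linarith)] at C
  rw [aux_arg' _ (by linarith) (by linarith), aux_arg' _ (by linarith) (by linarith)] at E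
  have := Real.pi_pos
  linarith


open Complex in
/-- **Lemma 7.3.1**: for four distinct points `v 0`, `v 1`, `v 2`, `v 3`
occurring in that (cyclic) order on the boundary of a topological disk `κ` in
the plane (identified with `ℂ`), every open Jordan curve included in `κ`
joining `v 0` and `v 2` intersects every open Jordan curve included in `κ`
joining `v 1` and `v 3`.

The topological disk is given by a closed set `κ` together with a
homeomorphism `h` onto the closed unit disk; the four boundary points are
the preimages of circle points at angles `θ 0 < θ 1 < θ 2 < θ 3 < θ 0 + 2π`,
and the two Jordan curves are the images of injective continuous maps on
`[0,1]` with the prescribed end points. -/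
theorem jordan_curves_in_disk_intersect (κ : Set ℂ) (hclosed : IsClosed κ)
    (h : κ ≃ₜ (Metric.closedBall (0 : ℂ) 1))
    (v : Fin 4 → ℂ) (hvκ : ∀ i, v i ∈ κ) (hvinj : Function.Injective v)
    (θ : Fin 4 → ℝ)
    (hord : θ 0 < θ 1 ∧ θ 1 < θ 2 ∧ θ 2 < θ 3 ∧ θ 3 < θ 0 + 2 * Real.pi)
    (hbd : ∀ i, ((h ⟨v i, hvκ i⟩ : Metric.closedBall (0 : ℂ) 1) : ℂ) =
      Complex.exp (θ i * Complex.I))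
    (f g : ℝ → ℂ)
    (hfc : ContinuousOn f (Set.Icc 0 1)) (hfinj : Set.InjOn f (Set.Icc 0 1))
    (hf0 : f 0 = v 0) (hf1 : f 1 = v 2) (hfκ : f '' Set.Icc 0 1 ⊆ κ)
    (hgc : ContinuousOn g (Set.Icc 0 1)) (hginj : Set.InjOn g (Set.Icc 0 1))
    (hg0 : g 0 = v 1) (hg1 : g 1 = v 3) (hgκ : g '' Set.Icc 0 1 ⊆ κ) :
    ∃ p : ℂ, p ∈ f '' Set.Icc 0 1 ∧ p ∈ g '' Set.Icc 0 1 := by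

  have mem : ∀ k : ℝ → ℂ, k '' Set.Icc 0 1 ⊆ κ → ∀ t : ℝ,
      k (Set.projIcc (0 : ℝ) 1 zero_le_one t) ∈ κ :=
    fun k hk t => hk ⟨_, (Set.projIcc (0 : ℝ) 1 zero_le_one t).2, rfl⟩
  have cont : ∀ (k : ℝ → ℂ) (hk : k '' Set.Icc 0 1 ⊆ κ), ContinuousOn k (Set.Icc 0 1) →
      Continuous (fun t : ℝ => ((h ⟨_, mem k hk t⟩ : Metric.closedBall (0 : ℂ) 1) : ℂ)) := by
    intro k hk hc
    refine continuous_subtype_val.comp (h.continuous.comp (Continuous.subtype_mk ?_ _))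
    exact (continuousOn_iff_continuous_domRestrict.1 hc).comp continuous_projIcc
  have nrm : ∀ z : Metric.closedBall (0 : ℂ) 1, ‖(z : ℂ)‖ ≤ 1 := fun z => by
    exact mem_closedBall_zero_iff.1 z.2
  obtain ⟨s, t, hst⟩ := aux_main θ hord _ _ (cont f hfκ hfc) (cont g hgκ hgc)
    (fun t => nrm _) (fun t => nrm _)
    (by simp only [Set.projIcc_left, hf0, hbd]) (by simp only [Set.projIcc_right, hf1, hbd])
    (by simp only [Set.projIcc_left, hg0, hbd]) (by simp only [Set.projIcc_right, hg1, hbd])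
  have := congrArg Subtype.val (h.injective (Subtype.ext hst))
  exact ⟨_, ⟨_, (Set.projIcc (0 : ℝ) 1 zero_le_one s).2, rfl⟩,
    ⟨_, (Set.projIcc (0 : ℝ) 1 zero_le_one t).2, this.symm⟩⟩
end
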